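/- Let G = ℤ/Nℤ with N odd, let B be a regular Bohr set of rank d, and let L ≥ 1 be an integer. Let ρ ≤ 1/(100Ld), and let ν : G → ℝ_{≥0} be a probability measure supported on the L-fold sumset B_ρ + ⋯ + B_ρ (L copies). Then 1_B(x) ≤ 1_{B_{1+Lρ}}∗ν(x) for all x ∈ G, and μ_B(x) ≤ 2·μ_{B_{1+Lρ}}∗ν(x) for all x ∈ G. -/

import Mathlib

open Finset BigOperators Pointwise
open scoped Classical

namespace Formal

variable {G : Type*} [AddCommGroup G] [Fintype G]

/-- `ex f = 𝔼_{x ∈ G} f x`. -/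
noncomputable def ex (f : G → ℝ) : ℝ := (∑ x, f x) / (Fintype.card G : ℝ)

/-- `ip f g = ⟨f, g⟩ = 𝔼_x f x * g x`. -/
noncomputable def ip (f g : G → ℝ) : ℝ := ex (fun x => f x * g x)

/-- `ipWt ν f g = ⟨f, g⟩_ν = 𝔼_x f x * g x * ν x`. -/
noncomputable def ipWt (ν f g : G → ℝ) : ℝ := ex (fun x => f x * g x * ν x)

/-- Convolution `f ∗ g (x) = 𝔼_y f y * g (x - y)`. -/
noncomputable def cv (f g : G → ℝ) : G → ℝ := fun x => ex (fun y => f y * g (x - y))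

/-- Difference convolution `f ∘ g (x) = 𝔼_y f y * g (x + y)`. -/
noncomputable def dcv (f g : G → ℝ) : G → ℝ := fun x => ex (fun y => f y * g (x + y))

/-- Normalized indicator measure `μ_A = (|G|/|A|) · 1_A`. -/
noncomputable def mu (A : Set G) : G → ℝ :=
  fun x => if x ∈ A then (Fintype.card G : ℝ) / (Nat.card A : ℝ) else 0

/-- Density `|A|/|G|`. -/
noncomputable def density (A : Set G) : ℝ := (Nat.card A : ℝ) / (Fintype.card G : ℝ)

/-- Relative density `|A|/|B|`. -/
noncomputable def relDensity (A B : Set G) : ℝ := (Nat.card A : ℝ) / (Nat.card B : ℝ)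

/-- `‖f‖_p = (𝔼_x |f x|^p)^{1/p}`. -/
noncomputable def lpNorm (p : ℝ) (f : G → ℝ) : ℝ := (ex (fun x => |f x| ^ p)) ^ (1 / p)

/-- `‖f‖_{p(ν)} = (𝔼_x |f x|^p ν x)^{1/p}`. -/
noncomputable def lpNormWt (p : ℝ) (ν f : G → ℝ) : ℝ := (ex (fun x => |f x| ^ p * ν x)) ^ (1 / p)

/-- `‖f‖_∞ = max_x |f x|`. -/
noncomputable def linftyNorm (f : G → ℝ) : ℝ := ⨆ x, |f x|

/-- `‖f‖_1 = 𝔼_x |f x|`. -/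
noncomputable def l1Norm (f : G → ℝ) : ℝ := ex (fun x => |f x|)

/-- Indicator function of a set. -/
noncomputable def indic (S : Set G) : G → ℝ := fun x => if x ∈ S then 1 else 0

/-- `Lq α = log (2/α)`. -/
noncomputable def Lq (α : ℝ) : ℝ := Real.log (2 / α)

/-- `iterConv f k` is the `k`-fold convolution `f ∗ ⋯ ∗ f` (for `k ≥ 1`);
`iterConv f 0` is the convolution identity. -/
noncomputable def iterConv (f : G → ℝ) : ℕ → G → ℝ
  | 0 => fun x => if x = 0 then (Fintype.card G : ℝ) else 0
  | n + 1 => cv (iterConv f n) f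

/-- Fourier transform `f̂ γ = 𝔼_x f x * conj (γ x)`. -/
noncomputable def ft (f : G → ℝ) (γ : AddChar G ℂ) : ℂ :=
  (∑ x, (f x : ℂ) * (starRingEnd ℂ) (γ x)) / (Fintype.card G : ℝ)

/-- The large spectrum `Δ_{1/2}(X)` of the measure `μ_X`. -/
noncomputable def Delta (X : Set G) : Set (AddChar G ℂ) :=
  {γ | 1 / 2 ≤ ‖ft (mu X) γ‖}

/-- A Bohr set: a finite set of characters together with a radius. -/
structure Bohr (G : Type*) [AddCommGroup G] where
  freq : Finset (AddChar G ℂ)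
  radius : ℝ

namespace Bohr

variable {G : Type*} [AddCommGroup G]

/-- The underlying set `{x : |1 - γ x| ≤ ρ for all γ ∈ Λ}` of a Bohr set. -/
def carrier (B : Bohr G) : Set G := {x | ∀ γ ∈ B.freq, ‖(1 : ℂ) - γ x‖ ≤ B.radius}

/-- The rank `|Λ|` of a Bohr set. -/
def rank (B : Bohr G) : ℕ := B.freq.card

/-- The dilate `B_δ` of a Bohr set. -/
def dilate (B : Bohr G) (δ : ℝ) : Bohr G := ⟨B.freq, δ * B.radius⟩

/-- A Bohr set of rank `d` is regular if for all `|κ| ≤ 1/(100d)`,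
`(1 - 100d|κ|)|B| ≤ |B_{1+κ}| ≤ (1 + 100d|κ|)|B|`. -/
def Regular (B : Bohr G) : Prop :=
  ∀ κ : ℝ, |κ| ≤ 1 / (100 * B.rank) →
    (1 - 100 * B.rank * |κ|) * (Nat.card B.carrier : ℝ) ≤
        (Nat.card ((B.dilate (1 + κ)).carrier) : ℝ) ∧
    (Nat.card ((B.dilate (1 + κ)).carrier) : ℝ) ≤
        (1 + 100 * B.rank * |κ|) * (Nat.card B.carrier : ℝ)

/-- `B' ⊂_r B` : `B'` is a regular dilate `B_δ` of `B` with `δ ∈ [r/2, r]`. -/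
def subR (r : ℝ) (B' B : Bohr G) : Prop :=
  ∃ δ : ℝ, r / 2 ≤ δ ∧ δ ≤ r ∧ B' = B.dilate δ ∧ B'.Regular

/-- The density `μ(B) = |B|/|G|` of a Bohr set. -/
noncomputable def dens (B : Bohr G) : ℝ := (Nat.card B.carrier : ℝ) / (Nat.card G : ℝ)

end Bohr


theorem mu_eq_mul_indic {α : Type*} [Fintype α] (A : Set α) (x : α) :
    mu A x = (Fintype.card α : ℝ) / (Nat.card A : ℝ) * indic A x := by
  simp [mu, indic]

theorem indic_nonneg {α : Type*} (A : Set α) (x : α) : 0 ≤ indic A x := by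
  unfold indic
  split_ifs <;> norm_num

theorem cv_nonneg {f g : G → ℝ} (hf : ∀ x, 0 ≤ f x) (hg : ∀ x, 0 ≤ g x) (x : G) :
    0 ≤ cv f g x :=
  div_nonneg (Finset.sum_nonneg fun y _ => mul_nonneg (hf y) (hg _)) (Nat.cast_nonneg _)

theorem cv_mu (A : Set G) (g : G → ℝ) (x : G) :
    cv (mu A) g x = (Fintype.card G : ℝ) / (Nat.card A : ℝ) * cv (indic A) g x := by
  simp only [cv, ex, mu_eq_mul_indic, mul_assoc, ← Finset.mul_sum, mul_div_assoc]

theorem cv_indic_eq_ex {S : Set G} {g : G → ℝ} {x : G} (h : ∀ t, g t ≠ 0 → x - t ∈ S) :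
    cv (indic S) g x = ex g := by
  simp only [cv, ex]
  congr 1
  rw [← Equiv.sum_comp (Equiv.subLeft x) g]
  refine Finset.sum_congr rfl fun y _ => ?_
  rw [Equiv.subLeft_apply]
  by_cases hy : g (x - y) = 0
  · rw [hy, mul_zero]
  · have hmem := h _ hy
    rw [sub_sub_cancel] at hmem
    simp [indic, hmem]

theorem exists_ne_zero_of_ex_eq_one {α : Type*} [Fintype α] {f : α → ℝ} (h : ex f = 1) :
    ∃ x, f x ≠ 0 := by
  by_contra! hf
  simp [ex, hf] at h

theorem norm_one_sub_addChar_add_le (γ : AddChar G ℂ) (x y : G) :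
    ‖(1 : ℂ) - γ (x + y)‖ ≤ ‖(1 : ℂ) - γ x‖ + ‖(1 : ℂ) - γ y‖ := by
  have h : (1 : ℂ) - γ (x + y) = (1 - γ x) + γ x * (1 - γ y) := by
    rw [AddChar.map_add_eq_mul]
    ring
  rw [h]
  refine (norm_add_le _ _).trans ?_
  rw [norm_mul, AddChar.norm_apply, one_mul]

theorem norm_one_sub_addChar_neg (γ : AddChar G ℂ) (x : G) :
    ‖(1 : ℂ) - γ (-x)‖ = ‖(1 : ℂ) - γ x‖ := by
  have h : (1 : ℂ) - γ x = -(γ x * (1 - γ (-x))) := by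
    rw [mul_sub, ← AddChar.map_add_eq_mul, add_neg_cancel, AddChar.map_zero_eq_one]
    ring
  rw [h, norm_neg, norm_mul, AddChar.norm_apply, one_mul]

theorem norm_one_sub_addChar_sum_le (γ : AddChar G ℂ) {ι : Type*} (s : Finset ι) (y : ι → G) :
    ‖(1 : ℂ) - γ (∑ i ∈ s, y i)‖ ≤ ∑ i ∈ s, ‖(1 : ℂ) - γ (y i)‖ := by
  induction s using Finset.induction_on with
  | empty => simp
  | insert a s ha ih =>
    rw [Finset.sum_insert ha, Finset.sum_insert ha]
    exact (norm_one_sub_addChar_add_le γ _ _).trans (by gcongr)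

namespace Bohr

variable {G : Type*} [AddCommGroup G]

theorem sub_sum_mem_carrier_dilate [Fintype G] {B : Bohr G} {ρ : ℝ} {L : ℕ} {x : G}
    (hx : x ∈ B.carrier)
    {y : Fin L → G} (hy : ∀ i, y i ∈ (B.dilate ρ).carrier) :
    x - ∑ i, y i ∈ (B.dilate (1 + L * ρ)).carrier := by
  intro γ hγ
  calc ‖(1 : ℂ) - γ (x - ∑ i, y i)‖
      ≤ ‖(1 : ℂ) - γ x‖ + ‖(1 : ℂ) - γ (∑ i, y i)‖ := by
        rw [sub_eq_add_neg x, ← norm_one_sub_addChar_neg γ (∑ i, y i)]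
        exact norm_one_sub_addChar_add_le γ _ _
    _ ≤ B.radius + ∑ _i : Fin L, ρ * B.radius :=
        add_le_add (hx γ hγ) ((norm_one_sub_addChar_sum_le γ _ _).trans
          (Finset.sum_le_sum fun i _ => hy i γ hγ))
    _ = (1 + L * ρ) * B.radius := by
        simp only [Finset.sum_const, Finset.card_univ, Fintype.card_fin, nsmul_eq_mul]
        ring

theorem carrier_dilate_of_freq_eq_empty {B : Bohr G} (h : B.freq = ∅) (δ : ℝ) :
    (B.dilate δ).carrier = B.carrier := by
  simp [carrier, dilate, h]

theorem carrier_dilate_of_radius_eq_zero {B : Bohr G} (h : B.radius = 0) (δ : ℝ) :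
    (B.dilate δ).carrier = B.carrier := by
  simp [carrier, dilate, h]

theorem Regular.card_dilate_le_two_mul {B : Bohr G} (hB : B.Regular) {L : ℕ} (hL : 1 ≤ L) {ρ : ℝ}
    (hρ : ρ ≤ 1 / (100 * L * B.rank)) (hne : B.carrier.Nonempty)
    (hneρ : (B.dilate ρ).carrier.Nonempty) :
    (Nat.card (B.dilate (1 + L * ρ)).carrier : ℝ) ≤ 2 * Nat.card B.carrier := by
  have hcard : (0 : ℝ) ≤ Nat.card B.carrier := Nat.cast_nonneg _
  rcases B.freq.eq_empty_or_nonempty with hfreq | ⟨γ, hγ⟩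
  · rw [carrier_dilate_of_freq_eq_empty hfreq]
    linarith
  rcases eq_or_ne B.radius 0 with hr | hr
  · rw [carrier_dilate_of_radius_eq_zero hr]
    linarith
  obtain ⟨x, hx⟩ := hne
  obtain ⟨y, hy⟩ := hneρ
  have hr_pos : 0 < B.radius := ((norm_nonneg _).trans (hx γ hγ)).lt_of_ne' hr
  have hρ_nonneg : 0 ≤ ρ :=
    nonneg_of_mul_nonneg_left ((norm_nonneg _).trans (hy γ hγ)) hr_pos
  have hL_pos : (0 : ℝ) < L := Nat.cast_pos.mpr hL
  have hrank : (0 : ℝ) < B.rank := Nat.cast_pos.mpr (Finset.card_pos.mpr ⟨γ, hγ⟩)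
  have hκ : 100 * B.rank * |L * ρ| ≤ 1 := by
    rw [abs_of_nonneg (by positivity)]
    rw [le_div_iff₀ (by positivity)] at hρ
    linarith
  have hκ' : |L * ρ| ≤ 1 / (100 * B.rank) := by
    rw [le_div_iff₀ (by positivity)]
    linarith
  refine (hB _ hκ').2.trans ?_
  gcongr
  linarith

end Bohr

/-- If `ν` is a probability measure supported on the `L`-fold sumset
`B_ρ + ⋯ + B_ρ` with `ρ ≤ 1/(100Ld)`, then `1_B ≤ 1_{B_{1+Lρ}}∗ν` and
`μ_B ≤ 2·μ_{B_{1+Lρ}}∗ν` pointwise. -/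
theorem statement13 (N : ℕ) [NeZero N] (hN : Odd N)
    (B : Bohr (ZMod N)) (d : ℕ) (hB : B.Regular) (hd : B.rank = d)
    (L : ℕ) (hL : 1 ≤ L) (ρ : ℝ) (hρ : ρ ≤ 1 / (100 * L * d))
    (ν : ZMod N → ℝ) (hν0 : ∀ x, 0 ≤ ν x) (hν1 : ex ν = 1)
    (hsupp : ∀ x, ν x ≠ 0 →
      ∃ y : Fin L → ZMod N, (∀ i, y i ∈ (B.dilate ρ).carrier) ∧ x = ∑ i, y i) :
    (∀ x, indic B.carrier x ≤ cv (indic ((B.dilate (1 + L * ρ)).carrier)) ν x) ∧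
    (∀ x, mu B.carrier x ≤ 2 * cv (mu ((B.dilate (1 + L * ρ)).carrier)) ν x) := by
  subst hd
  have hmem : ∀ x ∈ B.carrier, ∀ t, ν t ≠ 0 → x - t ∈ (B.dilate (1 + L * ρ)).carrier := by
    intro x hx t ht
    obtain ⟨y, hy, rfl⟩ := hsupp t ht
    exact Bohr.sub_sum_mem_carrier_dilate hx hy
  have hcv : ∀ x ∈ B.carrier, cv (indic (B.dilate (1 + L * ρ)).carrier) ν x = 1 :=
    fun x hx => (cv_indic_eq_ex (hmem x hx)).trans hν1
  refine ⟨fun x => ?_, fun x => ?_⟩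
  · by_cases hx : x ∈ B.carrier
    · simp [hcv x hx, indic, hx]
    · rw [indic, if_neg hx]
      exact cv_nonneg (indic_nonneg _) hν0 x
  · rw [cv_mu]
    by_cases hx : x ∈ B.carrier
    · obtain ⟨t, ht⟩ := exists_ne_zero_of_ex_eq_one hν1
      obtain ⟨y, hy, -⟩ := hsupp t ht
      have hcard := hB.card_dilate_le_two_mul hL hρ ⟨x, hx⟩ ⟨y ⟨0, hL⟩, hy _⟩
      have hpos : (0 : ℝ) < Nat.card (B.dilate (1 + L * ρ)).carrier :=
        have : Nonempty (B.dilate (1 + L * ρ)).carrier := ⟨⟨_, hmem x hx t ht⟩⟩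
        Nat.cast_pos.mpr Nat.card_pos
      rw [hcv x hx, mu, if_pos hx, mul_one, ← mul_div_assoc,
        div_le_div_iff₀ (by linarith) hpos]
      have := mul_le_mul_of_nonneg_left hcard (Nat.cast_nonneg (α := ℝ) (Fintype.card (ZMod N)))
      linarith
    · rw [mu, if_neg hx]
      have := cv_nonneg (indic_nonneg (B.dilate (1 + L * ρ)).carrier) hν0 x
      positivity

end Formal
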